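/- Infimum (dual) characterization over slowly varying sequences (sequence form of Lemma 2.9): let η ∈ (0,1). (i) For every sequence b : ℕ → [0,∞) and every α ∈ 𝒜_η one has (∑_{ℓ≥0} b_ℓ)² ≤ ∑_{ℓ≥0} α_ℓ^{−1} b_ℓ², where both sums are interpreted in the extended nonnegative reals [0,∞]. (ii) There exists C = C(η) ≥ 1 such that for every sequence b : ℕ → [0,∞) with ∑_{ℓ≥0} b_ℓ < ∞ there exists α ∈ 𝒜_η with ∑_{ℓ≥0} α_ℓ^{−1} b_ℓ² ≤ C (∑_{ℓ≥0} b_ℓ)². -/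

import Mathlib

/-- A slowly varying sequence with parameter `η`: a positive sequence summing to
`1` whose consecutive ratios lie in `[2^{−η}, 2^{η}]`. -/
def SlowlyVarying (η : ℝ) (α : ℕ → ℝ) : Prop :=
  (∀ ℓ, 0 < α ℓ) ∧ (∑' ℓ, α ℓ) = 1 ∧
    ∀ ℓ, (2 : ℝ) ^ (-η) ≤ α (ℓ + 1) / α ℓ ∧ α (ℓ + 1) / α ℓ ≤ (2 : ℝ) ^ η

/-- The Cauchy–Schwarz inequality against a positive weight of total mass `1`, in `[0,∞]`. -/
theorem tsum_ofReal_sq_le_tsum_sq_div {b α : ℕ → ℝ} (hb : ∀ ℓ, 0 ≤ b ℓ) (hα : ∀ ℓ, 0 < α ℓ)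
    (hα1 : ∑' ℓ, α ℓ = 1) :
    (∑' ℓ, ENNReal.ofReal (b ℓ)) ^ 2 ≤ ∑' ℓ, ENNReal.ofReal (b ℓ ^ 2 / α ℓ) := by
  have hs : Summable α := by
    by_contra h
    simp [tsum_eq_zero_of_not_summable h] at hα1
  have hlim : Filter.Tendsto (fun s : Finset ℕ => (∑ ℓ ∈ s, ENNReal.ofReal (b ℓ)) ^ 2)
      Filter.atTop (nhds ((∑' ℓ, ENNReal.ofReal (b ℓ)) ^ 2)) :=
    ((ENNReal.continuous_pow 2).tendsto _).comp ENNReal.summable.hasSum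
  refine le_of_tendsto' hlim fun s => ?_
  refine le_trans ?_ (ENNReal.sum_le_tsum s)
  have hdiv : ∀ ℓ, 0 ≤ b ℓ ^ 2 / α ℓ := fun ℓ => div_nonneg (sq_nonneg _) (hα ℓ).le
  rw [← ENNReal.ofReal_sum_of_nonneg fun ℓ _ => hb ℓ,
    ← ENNReal.ofReal_sum_of_nonneg fun ℓ _ => hdiv ℓ,
    ← ENNReal.ofReal_pow (Finset.sum_nonneg fun ℓ _ => hb ℓ)]
  refine ENNReal.ofReal_le_ofReal ?_
  have hle : ∑ ℓ ∈ s, α ℓ ≤ 1 := hα1 ▸ hs.sum_le_tsum s fun ℓ _ => (hα ℓ).le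
  calc (∑ ℓ ∈ s, b ℓ) ^ 2 ≤ (∑ ℓ ∈ s, α ℓ) * ∑ ℓ ∈ s, b ℓ ^ 2 / α ℓ :=
        Finset.sum_sq_le_sum_mul_sum_of_sq_le_mul s (fun ℓ _ => (hα ℓ).le) (fun ℓ _ => hdiv ℓ)
          fun ℓ _ => (mul_div_cancel₀ _ (hα ℓ).ne').ge
    _ ≤ ∑ ℓ ∈ s, b ℓ ^ 2 / α ℓ :=
        mul_le_of_le_one_left (Finset.sum_nonneg fun ℓ _ => hdiv ℓ) hle

/-- Two-sided geometric sequences are summable over `ℤ`. -/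
theorem summable_pow_natAbs {q : ℝ} (hq0 : 0 < q) (hq1 : q < 1) :
    Summable fun j : ℤ => q ^ j.natAbs := by
  have h := summable_geometric_of_lt_one hq0.le hq1
  exact Summable.of_nat_of_neg (by simpa using h) (by simpa using h)

/-- Normalizing a positive summable sequence with ratios in `[2^{−η}, 2^{η}]` gives a slowly
varying sequence. -/
theorem slowlyVarying_div_tsum {η : ℝ} {β : ℕ → ℝ} (hβ : ∀ ℓ, 0 < β ℓ) (hs : Summable β)
    (hlo : ∀ ℓ, (2 : ℝ) ^ (-η) * β ℓ ≤ β (ℓ + 1)) (hhi : ∀ ℓ, (2 : ℝ) ^ (-η) * β (ℓ + 1) ≤ β ℓ) :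
    SlowlyVarying η fun ℓ => β ℓ / ∑' k, β k := by
  have hT : 0 < ∑' k, β k := hs.tsum_pos (fun ℓ => (hβ ℓ).le) 0 (hβ 0)
  refine ⟨fun ℓ => div_pos (hβ ℓ) hT, by rw [tsum_div_const, div_self hT.ne'], fun ℓ => ?_⟩
  rw [div_div_div_cancel_right₀ hT.ne', le_div_iff₀ (hβ ℓ), div_le_iff₀ (hβ ℓ)]
  refine ⟨hlo ℓ, ?_⟩
  have h := hhi ℓ
  rwa [Real.rpow_neg zero_le_two, inv_mul_le_iff₀ (by positivity)] at h

/-- A nonzero summable nonnegative sequence has a summable positive majorant with consecutive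
ratios in `[q, q⁻¹]`, whose sum exceeds that of the sequence by at most a constant factor. -/
theorem exists_slow_majorant {q : ℝ} (hq0 : 0 < q) (hq1 : q < 1) {b : ℕ → ℝ}
    (hb : ∀ ℓ, 0 ≤ b ℓ) (hs : Summable b) {m : ℕ} (hm : 0 < b m) :
    ∃ β : ℕ → ℝ, (∀ ℓ, 0 < β ℓ) ∧ (∀ ℓ, b ℓ ≤ β ℓ) ∧ Summable β ∧
      (∀ ℓ, q * β ℓ ≤ β (ℓ + 1)) ∧ (∀ ℓ, q * β (ℓ + 1) ≤ β ℓ) ∧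
      ∑' ℓ, β ℓ ≤ (∑' j : ℤ, q ^ j.natAbs) * ∑' ℓ, b ℓ := by
  have hg := summable_pow_natAbs hq0 hq1
  let i : ℕ × ℕ → ℕ × ℤ := fun p => (p.2, (p.1 : ℤ) - p.2)
  have hi : Function.Injective i := by
    rintro ⟨a, c⟩ ⟨a', c'⟩ h
    simp only [i, Prod.mk.injEq] at h ⊢
    omega
  let G : ℕ × ℤ → ℝ := fun p => b p.1 * q ^ p.2.natAbs
  have hG0 : ∀ p, 0 ≤ G p := fun p => mul_nonneg (hb _) (by positivity)
  have hGs : Summable G := hs.mul_of_nonneg hg hb fun j => by positivity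
  let F : ℕ × ℕ → ℝ := fun p => G (i p)
  have hF0 : ∀ p, 0 ≤ F p := fun p => hG0 _
  have hFs : Summable F := hGs.comp_injective hi
  have hrow : ∀ ℓ, Summable fun k => F (ℓ, k) := fun ℓ => hFs.prod_factor ℓ
  have hmono : ∀ {x y : ℕ} (k : ℕ), ((y : ℤ) - k).natAbs ≤ ((x : ℤ) - k).natAbs + 1 →
      q * F (x, k) ≤ F (y, k) := by
    intro x y k h
    calc q * F (x, k) = b k * q ^ (((x : ℤ) - k).natAbs + 1) := by simp only [F, G, i]; ring
      _ ≤ F (y, k) := mul_le_mul_of_nonneg_left (pow_le_pow_of_le_one hq0.le hq1.le h) (hb k)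
  have hshift : ∀ {x y : ℕ}, (∀ k : ℕ, ((y : ℤ) - k).natAbs ≤ ((x : ℤ) - k).natAbs + 1) →
      q * ∑' k, F (x, k) ≤ ∑' k, F (y, k) := by
    intro x y h
    rw [← tsum_mul_left]
    exact ((hrow x).mul_left q).tsum_le_tsum (fun k => hmono k (h k)) (hrow y)
  refine ⟨fun ℓ => ∑' k, F (ℓ, k), fun ℓ => ?_, fun ℓ => ?_, hFs.prod, fun ℓ => ?_, fun ℓ => ?_, ?_⟩
  · exact (hrow ℓ).tsum_pos (fun k => hF0 _) m (mul_pos hm (by positivity))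
  · simpa [F, G, i] using (hrow ℓ).le_tsum ℓ fun k _ => hF0 (ℓ, k)
  · exact hshift fun k => by omega
  · exact hshift fun k => by omega
  · calc ∑' ℓ, ∑' k, F (ℓ, k) = ∑' p, F p := hFs.tsum_prod.symm
      _ ≤ ∑' p, G p := tsum_comp_le_tsum_of_inj hGs hG0 hi
      _ = (∑' j : ℤ, q ^ j.natAbs) * ∑' ℓ, b ℓ := by
        rw [mul_comm]; exact (hs.tsum_mul_tsum hg hGs).symm

/-- If `b ≤ β`, normalizing `β` gives a weight whose dual quadratic form at `b` is at most
`(∑ β) (∑ b)`. -/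
theorem tsum_sq_div_normalized_le {b β : ℕ → ℝ} (hb : ∀ ℓ, 0 ≤ b ℓ) (hsb : Summable b)
    (hβ : ∀ ℓ, 0 < β ℓ) (hle : ∀ ℓ, b ℓ ≤ β ℓ) :
    ∑' ℓ, ENNReal.ofReal (b ℓ ^ 2 / (β ℓ / ∑' k, β k)) ≤
      ENNReal.ofReal ((∑' ℓ, β ℓ) * ∑' ℓ, b ℓ) := by
  have hT : 0 ≤ ∑' k, β k := tsum_nonneg fun k => (hβ k).le
  rw [← tsum_mul_left, ENNReal.ofReal_tsum_of_nonneg (fun ℓ => mul_nonneg hT (hb ℓ))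
    (hsb.mul_left _)]
  refine ENNReal.tsum_le_tsum fun ℓ => ENNReal.ofReal_le_ofReal ?_
  rw [div_div_eq_mul_div, div_le_iff₀ (hβ ℓ)]
  calc b ℓ ^ 2 * ∑' k, β k = (∑' k, β k) * b ℓ * b ℓ := by ring
    _ ≤ (∑' k, β k) * b ℓ * β ℓ := mul_le_mul_of_nonneg_left (hle ℓ) (mul_nonneg hT (hb ℓ))

/-- **Infimum (dual) characterization over slowly varying sequences** (sequence
form of Lemma 2.9): let `η ∈ (0,1)`.
(i) For every sequence `b : ℕ → [0,∞)` and every `α ∈ 𝒜_η`,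
`(∑_ℓ b_ℓ)² ≤ ∑_ℓ α_ℓ⁻¹ b_ℓ²`, with both sums in `[0,∞]`.
(ii) There exists `C = C(η) ≥ 1` such that for every `b : ℕ → [0,∞)` with
`∑_ℓ b_ℓ < ∞` there exists `α ∈ 𝒜_η` with `∑_ℓ α_ℓ⁻¹ b_ℓ² ≤ C (∑_ℓ b_ℓ)²`. -/
theorem slowly_varying_inf_characterization (η : ℝ) (hη0 : 0 < η) (hη1 : η < 1) :
    (∀ b : ℕ → ℝ, (∀ ℓ, 0 ≤ b ℓ) →
      ∀ α : ℕ → ℝ, SlowlyVarying η α →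
        (∑' ℓ, ENNReal.ofReal (b ℓ)) ^ 2
          ≤ ∑' ℓ, ENNReal.ofReal (b ℓ ^ 2 / α ℓ))
    ∧ (∃ C : ℝ, 1 ≤ C ∧
        ∀ b : ℕ → ℝ, (∀ ℓ, 0 ≤ b ℓ) → Summable b →
          ∃ α : ℕ → ℝ, SlowlyVarying η α ∧
            (∑' ℓ, ENNReal.ofReal (b ℓ ^ 2 / α ℓ))
              ≤ ENNReal.ofReal (C * (∑' ℓ, b ℓ) ^ 2)) := by
  refine ⟨fun b hb α hα => tsum_ofReal_sq_le_tsum_sq_div hb hα.1 hα.2.1, ?_⟩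
  have hq0 : (0 : ℝ) < 2 ^ (-η) := by positivity
  have hq1 : (2 : ℝ) ^ (-η) < 1 := Real.rpow_lt_one_of_one_lt_of_neg one_lt_two (by linarith)
  refine ⟨∑' j : ℤ, ((2 : ℝ) ^ (-η)) ^ j.natAbs, ?_, fun b hb hs => ?_⟩
  · simpa using (summable_pow_natAbs hq0 hq1).le_tsum 0 fun j _ => by positivity
  by_cases hz : ∀ m, b m = 0
  · obtain ⟨β, hβ, -, hβs, hlo, hhi, -⟩ := exists_slow_majorant hq0 hq1
      (b := Pi.single 0 1) (fun ℓ => by by_cases h : ℓ = 0 <;> simp [h])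
      (hasSum_pi_single 0 1).summable (m := 0) (by simp)
    exact ⟨_, slowlyVarying_div_tsum hβ hβs hlo hhi, by simp [hz]⟩
  · push Not at hz
    obtain ⟨m, hm⟩ := hz
    obtain ⟨β, hβ, hle, hβs, hlo, hhi, hsum⟩ :=
      exists_slow_majorant hq0 hq1 hb hs ((hb m).lt_of_ne' hm)
    refine ⟨_, slowlyVarying_div_tsum hβ hβs hlo hhi,
      (tsum_sq_div_normalized_le hb hs hβ hle).trans (ENNReal.ofReal_le_ofReal ?_)⟩
    rw [sq, ← mul_assoc]
    exact mul_le_mul_of_nonneg_right hsum (tsum_nonneg hb)
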